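/- Let n be a natural number and let L : Fin n → Fin n → ℝ and M : Fin n → Fin n → Fin n → ℝ be coefficient arrays, with L symmetric (L i j = L j i) and M symmetric under all permutations of its three indices. Define Q(ξ) = Σ_{i,j} L i j · ξ i · ξ j, C(ξ) = Σ_{i,j,k} M i j k · ξ i · ξ j · ξ k and the thermodynamic Lagrangian density ρ_L(ξ) = Q(ξ)/2 + C(ξ)/3. If ξ : Fin n → ℝ is a critical point of ρ_L, i.e. the Fréchet derivative of ρ_L at ξ is the zero map, then Q(ξ) + C(ξ) = 0 and ρ_L(ξ) = Q(ξ)/6 = −C(ξ)/6; in particular, at critical points ρ_L is determined entirely by the cubic (completely non-linear) part: ρ_L(ξ) = −(1/6) Σ_{i,j,k} M i j k · ξ i · ξ j · ξ k. -/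

import Mathlib

/-- At a critical point of the thermodynamic Lagrangian density
ρ_L = Q/2 + C/3 (with symmetric Onsager coefficients), the Euler identity
gives Q + C = 0, hence ρ_L = Q/6 = −C/6: at critical points ρ_L is
determined entirely by the cubic, completely non-linear, part. -/
theorem lagrangian_at_critical_point (n : ℕ)
    (L : Fin n → Fin n → ℝ) (M : Fin n → Fin n → Fin n → ℝ)
    (hL : ∀ i j, L i j = L j i)
    (hM₁ : ∀ i j k, M i j k = M j i k)
    (hM₂ : ∀ i j k, M i j k = M i k j)
    (Q C ρL : (Fin n → ℝ) → ℝ)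
    (hQ : ∀ ξ, Q ξ = ∑ i, ∑ j, L i j * ξ i * ξ j)
    (hC : ∀ ξ, C ξ = ∑ i, ∑ j, ∑ k, M i j k * ξ i * ξ j * ξ k)
    (hρL : ∀ ξ, ρL ξ = Q ξ / 2 + C ξ / 3)
    (ξ : Fin n → ℝ) (hcrit : fderiv ℝ ρL ξ = 0) :
    Q ξ + C ξ = 0 ∧ ρL ξ = Q ξ / 6 ∧ ρL ξ = -C ξ / 6 ∧
    ρL ξ = -(1/6) * ∑ i, ∑ j, ∑ k, M i j k * ξ i * ξ j * ξ k := by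
  have hd : DifferentiableAt ℝ ρL ξ := by
    have : ρL = fun ξ => (∑ i, ∑ j, L i j * ξ i * ξ j) / 2
        + (∑ i, ∑ j, ∑ k, M i j k * ξ i * ξ j * ξ k) / 3 := by
      funext x
      rw [hρL, hQ, hC]
    rw [this]
    fun_prop
  have hf : HasFDerivAt ρL (0 : (Fin n → ℝ) →L[ℝ] ℝ) ((1 : ℝ) • ξ) := by
    rw [one_smul, ← hcrit]
    exact hd.hasFDerivAt
  have hs : HasDerivAt (fun t : ℝ => t • ξ) ((1 : ℝ) • ξ) 1 :=
    (hasDerivAt_id (1 : ℝ)).smul_const ξ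
  have h1 : HasDerivAt (fun t : ℝ => ρL (t • ξ)) 0 1 := by
    simpa [Function.comp_def] using hf.comp_hasDerivAt (1 : ℝ) hs
  have hQs : ∀ t : ℝ, Q (t • ξ) = t ^ 2 * Q ξ := by
    intro t
    simp only [hQ, Finset.mul_sum, Pi.smul_apply, smul_eq_mul]
    refine Finset.sum_congr rfl fun i _ => Finset.sum_congr rfl fun j _ => ?_
    ring
  have hCs : ∀ t : ℝ, C (t • ξ) = t ^ 3 * C ξ := by
    intro t
    simp only [hC, Finset.mul_sum, Pi.smul_apply, smul_eq_mul]
    refine Finset.sum_congr rfl fun i _ => Finset.sum_congr rfl fun j _ =>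
      Finset.sum_congr rfl fun k _ => ?_
    ring
  have h2 : HasDerivAt (fun t : ℝ => ρL (t • ξ)) (Q ξ + C ξ) 1 := by
    have he : (fun t : ℝ => ρL (t • ξ)) = fun t => t ^ 2 * Q ξ / 2 + t ^ 3 * C ξ / 3 := by
      funext t
      rw [hρL, hQs, hCs]
    rw [he]
    have h := (((hasDerivAt_pow 2 (1 : ℝ)).mul_const (Q ξ)).div_const 2).add
      (((hasDerivAt_pow 3 (1 : ℝ)).mul_const (C ξ)).div_const 3)
    refine h.congr_deriv ?_
    norm_num
  have h0 : Q ξ + C ξ = 0 := h2.unique h1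
  have hr := hρL ξ
  refine ⟨h0, by linarith, by linarith, ?_⟩
  rw [← hC]
  linarith
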